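/- arXiv:math/9909148 — 5 statements merged into one kernel-verified Lean document; each statement's English description precedes it below -/
import Mathlib

section
/- Let I ⊆ ℝ be a nonempty open interval and σ = (t, x, y) : I → ℝ × ℝⁿ × ℝⁿ a differentiable curve with t′(s) ≠ 0 for all s ∈ I and satisfying the contact condition x′(s) = t′(s)·y(s) for all s ∈ I. Then t is injective on I, t(I) is an open interval, and there exists a differentiable curve γ : t(I) → ℝⁿ with γ(t(s)) = x(s) and γ′(t(s)) = y(s) for all s ∈ I; that is, σ is a reparametrization of the first prolongation j¹γ : τ ↦ (τ, γ(τ), γ′(τ)). -/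
open Set Filter Topology

/-- A continuous strictly monotone real function maps neighbourhoods to neighbourhoods. -/
theorem StrictMonoOn.image_mem_nhds_of_continuousOn {f : ℝ → ℝ} {U : Set ℝ} {s : ℝ}
    (hf : StrictMonoOn f U) (hc : ContinuousOn f U) (hU : U ∈ 𝓝 s) : f '' U ∈ 𝓝 (f s) := by
  obtain ⟨ε, hε, hball⟩ := Metric.nhds_basis_closedBall.mem_iff.1 hU
  rw [Real.closedBall_eq_Icc] at hball
  have hl : s - ε ∈ U := hball ⟨le_rfl, by linarith⟩
  have hr : s + ε ∈ U := hball ⟨by linarith, le_rfl⟩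
  have hs : s ∈ U := mem_of_mem_nhds hU
  refine mem_of_superset (Icc_mem_nhds (hf hl hs (by linarith)) (hf hs hr (by linarith))) ?_
  exact (intermediate_value_Icc (by linarith) (hc.mono hball)).trans (image_mono hball)

/-- A continuous strictly antitone real function maps neighbourhoods to neighbourhoods. -/
theorem StrictAntiOn.image_mem_nhds_of_continuousOn {f : ℝ → ℝ} {U : Set ℝ} {s : ℝ}
    (hf : StrictAntiOn f U) (hc : ContinuousOn f U) (hU : U ∈ 𝓝 s) : f '' U ∈ 𝓝 (f s) := by
  have h := StrictMonoOn.image_mem_nhds_of_continuousOn hf.neg hc.neg hU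
  have h' := (continuous_neg.tendsto (f s)) h
  refine mem_of_superset h' ?_
  rintro z ⟨u, hu, huz⟩
  exact ⟨u, hu, neg_injective huz⟩

/-- A real function with nonvanishing derivative on an interval is injective there and maps
neighbourhoods to neighbourhoods. -/
theorem injOn_and_image_mem_nhds_of_hasDerivAt_ne_zero {I : Set ℝ} (hconn : I.OrdConnected)
    {t t' : ℝ → ℝ} (ht : ∀ s ∈ I, HasDerivAt t (t' s) s) (ht' : ∀ s ∈ I, t' s ≠ 0) :
    InjOn t I ∧ ∀ U ⊆ I, ∀ s, U ∈ 𝓝 s → t '' U ∈ 𝓝 (t s) := by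
  have hc : ContinuousOn t I := fun s hs => (ht s hs).continuousAt.continuousWithinAt
  rcases hasDerivWithinAt_forall_lt_or_forall_gt_of_forall_ne hconn.convex
    (fun s hs => (ht s hs).hasDerivWithinAt) ht' with h | h
  · have hm : StrictAntiOn t I := strictAntiOn_of_hasDerivWithinAt_neg hconn.convex hc
      (fun s hs => (ht s (interior_subset hs)).hasDerivWithinAt)
      (fun s hs => h s (interior_subset hs))
    exact ⟨hm.injOn, fun U hU s hs =>
      (hm.mono hU).image_mem_nhds_of_continuousOn (hc.mono hU) hs⟩
  · have hm : StrictMonoOn t I := strictMonoOn_of_hasDerivWithinAt_pos hconn.convex hc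
      (fun s hs => (ht s (interior_subset hs)).hasDerivWithinAt)
      (fun s hs => h s (interior_subset hs))
    exact ⟨hm.injOn, fun U hU s hs =>
      (hm.mono hU).image_mem_nhds_of_continuousOn (hc.mono hU) hs⟩


/-- A differentiable curve `σ = (t,x,y)` in the first jet bundle with `t′ ≠ 0`
satisfying the contact condition `x′ = t′·y` is a reparametrization of the first
prolongation `j¹γ : τ ↦ (τ, γ(τ), γ′(τ))` of a differentiable curve
`γ : t(I) → ℝⁿ`: `t` is injective, `t(I)` is an open interval, and there is a
differentiable `γ` with `γ(t(s)) = x(s)` and `γ′(t(s)) = y(s)`. -/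
theorem contact_curve_is_prolongation (n : ℕ) (I : Set ℝ) (hI : IsOpen I)
    (hne : I.Nonempty) (hconn : I.OrdConnected)
    (t t' : ℝ → ℝ) (x y x' : ℝ → Fin n → ℝ)
    (ht : ∀ s ∈ I, HasDerivAt t (t' s) s)
    (hx : ∀ s ∈ I, HasDerivAt x (x' s) s)
    (ht' : ∀ s ∈ I, t' s ≠ 0)
    (hcontact : ∀ s ∈ I, x' s = t' s • y s) :
    Set.InjOn t I ∧ IsOpen (t '' I) ∧ (t '' I).OrdConnected ∧
      ∃ γ γ' : ℝ → Fin n → ℝ,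
        (∀ τ ∈ t '' I, HasDerivAt γ (γ' τ) τ) ∧
        ∀ s ∈ I, γ (t s) = x s ∧ γ' (t s) = y s := by
  have hc : ContinuousOn t I := fun s hs => (ht s hs).continuousAt.continuousWithinAt
  obtain ⟨hinj, himage⟩ := injOn_and_image_mem_nhds_of_hasDerivAt_ne_zero hconn ht ht'
  have hopen : IsOpen (t '' I) := by
    rw [isOpen_iff_mem_nhds]
    rintro _ ⟨s, hs, rfl⟩
    exact himage I subset_rfl s (hI.mem_nhds hs)
  refine ⟨hinj, hopen, (hconn.isPreconnected.image t hc).ordConnected, ?_⟩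
  set g := Function.invFunOn t I
  have hg : ∀ s ∈ I, g (t s) = s := hinj.leftInvOn_invFunOn
  refine ⟨x ∘ g, y ∘ g, ?_, fun s hs => by simp [hg s hs]⟩
  rintro _ ⟨s, hs, rfl⟩
  have hgc : ContinuousAt g (t s) := by
    intro V hV
    rw [hg s hs] at hV
    refine mem_map.2 (mem_of_superset
      (himage (V ∩ I) inter_subset_right s (inter_mem hV (hI.mem_nhds hs))) ?_)
    rintro _ ⟨u, ⟨huV, huI⟩, rfl⟩
    simpa [hg u huI] using huV
  have hgd : HasDerivAt g (t' s)⁻¹ (t s) := by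
    refine HasDerivAt.of_local_left_inverse hgc (by simpa [hg s hs] using ht s hs) (ht' s hs) ?_
    filter_upwards [hopen.mem_nhds (mem_image_of_mem t hs)]
    rintro _ ⟨u, hu, rfl⟩
    rw [hg u hu]
  have hxg : HasDerivAt x (x' s) (g (t s)) := by simpa [hg s hs] using hx s hs
  have h := hxg.scomp (t s) hgd
  rwa [hcontact s hs, inv_smul_smul₀ (ht' s hs), ← congrArg y (hg s hs)] at h
end

section
/- For arbitrary smooth Γ, N, and symmetric Γ^l_{rs}, the forms τ, ω, φ, Π satisfy the holonomic and torsion-free structure equations at every point p ∈ P and for all tangent vectors u, v: dτ = 0 and dω + Π ∧ ω + φ ∧ τ = 0. (This is the curvature condition T = 0 and Ω = 0 making the associated Galilean geometry normal.) -/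
attribute [local instance] Matrix.normedAddCommGroup Matrix.normedSpace

/-- The base space `ℝ × ℝⁿ × ℝⁿ` (first jet bundle coordinates `(t,x,y)`). -/
abbrev JetPt (n : ℕ) := ℝ × (Fin n → ℝ) × (Fin n → ℝ)

/-- The ambient vector space of the bundle `P = ℝ × ℝⁿ × ℝⁿ × GL_n(ℝ)`;
a point is `p = (t,x,y,A)` and a tangent vector is `ξ = (ξ_t, ξ_x, ξ_y, ξ_A)`. -/
abbrev GalTot (n : ℕ) := ℝ × (Fin n → ℝ) × (Fin n → ℝ) × Matrix (Fin n) (Fin n) ℝ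

/-- Projection `(t,x,y,A) ↦ (t,x,y)`. -/
def baseOf {n : ℕ} (p : GalTot n) : JetPt n := (p.1, p.2.1, p.2.2.1)

/-- The 1-form `τ_p(ξ) = ξ_t`. -/
def tauF {n : ℕ} (_p ξ : GalTot n) : ℝ := ξ.1

/-- The 1-form `ω_p(ξ) = A⁻¹(ξ_x − ξ_t y)`. -/
noncomputable def omegaF {n : ℕ} (p ξ : GalTot n) : Fin n → ℝ :=
  (p.2.2.2)⁻¹.mulVec (ξ.2.1 - ξ.1 • p.2.2.1)

/-- The 1-form `φ_p(ξ) = A⁻¹(ξ_y + ξ_t Γ(t,x,y) + N(t,x,y)(ξ_x − ξ_t y))`. -/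
noncomputable def phiF {n : ℕ} (Γ : JetPt n → Fin n → ℝ) (N : JetPt n → Matrix (Fin n) (Fin n) ℝ)
    (p ξ : GalTot n) : Fin n → ℝ :=
  (p.2.2.2)⁻¹.mulVec
    (ξ.2.2.1 + ξ.1 • Γ (baseOf p) + (N (baseOf p)).mulVec (ξ.2.1 - ξ.1 • p.2.2.1))

/-- The `M_n(ℝ)`-valued 1-form
`Π_p(ξ)^i_j = (A⁻¹ξ_A)^i_j + ξ_t (A⁻¹NA)^i_j + Σ_{l,r,s} (A⁻¹)^i_l Γ^l_{rs} A^r_j (ξ_x − ξ_t y)^s`. -/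
noncomputable def piF {n : ℕ} (N : JetPt n → Matrix (Fin n) (Fin n) ℝ)
    (Γ3 : JetPt n → Fin n → Fin n → Fin n → ℝ) (p ξ : GalTot n) :
    Matrix (Fin n) (Fin n) ℝ :=
  (p.2.2.2)⁻¹ * ξ.2.2.2 + ξ.1 • ((p.2.2.2)⁻¹ * N (baseOf p) * p.2.2.2) +
    Matrix.of fun i j => ∑ l, ∑ r, ∑ s,
      (p.2.2.2)⁻¹ i l * Γ3 (baseOf p) l r s * p.2.2.2 r j * (ξ.2.1 - ξ.1 • p.2.2.1) s

/-- Exterior derivative of a (vector- or matrix-valued) 1-form, evaluated on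
constant vectors: `dα_p(u,v) = D(q ↦ α_q(v))(p)(u) − D(q ↦ α_q(u))(p)(v)`. -/
noncomputable def dF {n : ℕ} {V : Type*} [NormedAddCommGroup V] [NormedSpace ℝ V]
    (α : GalTot n → GalTot n → V) (p u v : GalTot n) : V :=
  fderiv ℝ (fun q => α q v) p u - fderiv ℝ (fun q => α q u) p v

/-- Wedge of a matrix-valued form with a vector-valued form:
`(β ∧ α)_p(u,v) = β_p(u)·α_p(v) − β_p(v)·α_p(u)`. -/
def mvWedge {n : ℕ} (β : GalTot n → GalTot n → Matrix (Fin n) (Fin n) ℝ)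
    (α : GalTot n → GalTot n → Fin n → ℝ) (p u v : GalTot n) : Fin n → ℝ :=
  (β p u).mulVec (α p v) - (β p v).mulVec (α p u)

/-- Wedge of a vector-valued form with a scalar-valued form:
`(α ∧ β)_p(u,v) = α_p(u)·β_p(v) − α_p(v)·β_p(u)`. -/
def vsWedge {n : ℕ} (α : GalTot n → GalTot n → Fin n → ℝ)
    (β : GalTot n → GalTot n → ℝ) (p u v : GalTot n) : Fin n → ℝ :=
  β p v • α p u - β p u • α p v

/-- Wedge of two matrix-valued forms:
`(β ∧ γ)_p(u,v) = β_p(u)·γ_p(v) − β_p(v)·γ_p(u)`. -/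
def mmWedge {n : ℕ} (β γ : GalTot n → GalTot n → Matrix (Fin n) (Fin n) ℝ)
    (p u v : GalTot n) : Matrix (Fin n) (Fin n) ℝ :=
  β p u * γ p v - β p v * γ p u

/-- The curvature 2-form `Φ = dφ + Π ∧ φ`. -/
noncomputable def curvPhi {n : ℕ} (Γ : JetPt n → Fin n → ℝ) (N : JetPt n → Matrix (Fin n) (Fin n) ℝ)
    (Γ3 : JetPt n → Fin n → Fin n → Fin n → ℝ) (p u v : GalTot n) : Fin n → ℝ :=
  dF (phiF Γ N) p u v + mvWedge (piF N Γ3) (phiF Γ N) p u v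

/-- Matrix inversion is differentiable at every invertible matrix. -/
theorem Matrix.differentiableAt_inv {n : ℕ} {A : Matrix (Fin n) (Fin n) ℝ} (hA : IsUnit A) :
    DifferentiableAt ℝ (fun B : Matrix (Fin n) (Fin n) ℝ => B⁻¹) A := by
  have entry (i j : Fin n) :
      Differentiable ℝ (fun B : Matrix (Fin n) (Fin n) ℝ => B i j) :=
    fun _ => differentiableAt_pi.1 (differentiableAt_pi.1 differentiableAt_id i) j
  have det_diff (F : Matrix (Fin n) (Fin n) ℝ → Matrix (Fin n) (Fin n) ℝ)
      (hF : ∀ i j, Differentiable ℝ fun B => F B i j) :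
      Differentiable ℝ fun B => (F B).det := by
    simp only [Matrix.det_apply']
    fun_prop
  have hdet : A.det ≠ 0 := ((Matrix.isUnit_iff_isUnit_det A).1 hA).ne_zero
  refine differentiableAt_pi.2 fun i => differentiableAt_pi.2 fun j => ?_
  simp only [Matrix.inv_def, Matrix.smul_apply, Ring.inverse_eq_inv', smul_eq_mul,
    Matrix.adjugate_apply]
  refine ((det_diff id entry A).inv hdet).mul (det_diff _ (fun k l => ?_) A)
  simp only [Matrix.updateRow_apply]
  split_ifs
  · exact differentiable_const _
  · exact entry k l

/-- The derivative of `q ↦ A⁻¹ (v_x - v_t y)` in the direction `u`. -/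
theorem fderiv_omegaF {n : ℕ} {p : GalTot n} (hp : IsUnit p.2.2.2) (u v : GalTot n) :
    fderiv ℝ (fun q => omegaF q v) p u =
      (p.2.2.2)⁻¹.mulVec (-(v.1 • u.2.2.1) - u.2.2.2.mulVec (omegaF p v)) := by
  have hdet : IsUnit p.2.2.2.det := (Matrix.isUnit_iff_isUnit_det _).1 hp
  have hinv : DifferentiableAt ℝ (fun q : GalTot n => (q.2.2.2)⁻¹) p :=
    (Matrix.differentiableAt_inv hp).comp p (by fun_prop : DifferentiableAt ℝ
      (fun q : GalTot n => q.2.2.2) p)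
  have hω : DifferentiableAt ℝ (fun q : GalTot n => omegaF q v) p := by
    refine differentiableAt_pi.2 fun i => ?_
    simp only [omegaF, Matrix.mulVec, dotProduct]
    refine DifferentiableAt.fun_sum fun j _ => DifferentiableAt.mul ?_ ?_
    · exact differentiableAt_pi.1 (differentiableAt_pi.1 hinv i) j
    · simp only [Pi.sub_apply, Pi.smul_apply]
      fun_prop
  have hev : ∀ᶠ q : GalTot n in nhds p,
      q.2.2.2.mulVec (omegaF q v) = v.2.1 - v.1 • q.2.2.1 := by
    have hc : Continuous fun q : GalTot n => q.2.2.2.det :=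
      Continuous.matrix_det (by fun_prop)
    filter_upwards [hc.continuousAt.eventually_ne hdet.ne_zero] with q hq
    rw [omegaF, Matrix.mulVec_mulVec, Matrix.mul_nonsing_inv _ (isUnit_iff_ne_zero.2 hq),
      Matrix.one_mulVec]
  have key : u.2.2.2.mulVec (omegaF p v) +
      p.2.2.2.mulVec (fderiv ℝ (fun q => omegaF q v) p u) = -(v.1 • u.2.2.1) := by
    ext i
    have hc : HasDerivAt (fun t : ℝ => p + t • u) u 0 := by
      have h := ((hasDerivAt_id (0 : ℝ)).smul_const u).const_add p
      rwa [one_smul] at h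
    have hc0 : p = p + (0 : ℝ) • u := by simp
    have hωc : HasDerivAt (fun t : ℝ => omegaF (p + t • u) v)
        (fderiv ℝ (fun q => omegaF q v) p u) 0 :=
      hω.hasFDerivAt.comp_hasDerivAt_of_eq (0 : ℝ) hc hc0
    have affine (a b : ℝ) : HasDerivAt (fun t : ℝ => a + t * b) b 0 := by
      simpa using ((hasDerivAt_id (0 : ℝ)).mul_const b).const_add a
    have hL := HasDerivAt.fun_sum (u := Finset.univ) fun j _ =>
      (affine (p.2.2.2 i j) (u.2.2.2 i j)).mul (hasDerivAt_pi.1 hωc j)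
    have hR := ((affine (p.2.2.1 i) (u.2.2.1 i)).const_mul v.1).const_sub (v.2.1 i)
    have hev' : ∀ᶠ t : ℝ in nhds 0, (p + t • u).2.2.2.mulVec (omegaF (p + t • u) v) =
        v.2.1 - v.1 • (p + t • u).2.2.1 :=
      hc.continuousAt.eventually (hc0 ▸ hev)
    have h := (hL.congr_of_eventuallyEq
      (hev'.mono fun t ht => (congrFun ht i).symm)).unique hR
    simpa [Matrix.mulVec, dotProduct, Finset.sum_add_distrib] using h
  rw [← key, add_sub_cancel_left, Matrix.mulVec_mulVec, Matrix.nonsing_inv_mul _ hdet,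
    Matrix.one_mulVec]

/-- The action of the connection form on a frame-coordinate vector `A⁻¹ x`. -/
theorem piF_mulVec {n : ℕ} (N : JetPt n → Matrix (Fin n) (Fin n) ℝ)
    (Γ3 : JetPt n → Fin n → Fin n → Fin n → ℝ) {p : GalTot n} (hp : IsUnit p.2.2.2)
    (u v : GalTot n) :
    (piF N Γ3 p u).mulVec (omegaF p v) =
      (p.2.2.2)⁻¹.mulVec (u.2.2.2.mulVec (omegaF p v) +
        u.1 • (N (baseOf p)).mulVec (v.2.1 - v.1 • p.2.2.1) +
        fun l => ∑ r, ∑ s, Γ3 (baseOf p) l r s *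
          (v.2.1 - v.1 • p.2.2.1) r * (u.2.1 - u.1 • p.2.2.1) s) := by
  have hdet : IsUnit p.2.2.2.det := (Matrix.isUnit_iff_isUnit_det _).1 hp
  have hA : p.2.2.2.mulVec (omegaF p v) = v.2.1 - v.1 • p.2.2.1 := by
    rw [omegaF, Matrix.mulVec_mulVec, Matrix.mul_nonsing_inv _ hdet, Matrix.one_mulVec]
  have hΓ : (Matrix.of fun i j => ∑ l, ∑ r, ∑ s,
      (p.2.2.2)⁻¹ i l * Γ3 (baseOf p) l r s * p.2.2.2 r j * (u.2.1 - u.1 • p.2.2.1) s) =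
      (p.2.2.2)⁻¹ * ((Matrix.of fun l r => ∑ s, Γ3 (baseOf p) l r s *
        (u.2.1 - u.1 • p.2.2.1) s) * p.2.2.2) := by
    ext i j
    simp only [Matrix.of_apply, Matrix.mul_apply, Finset.mul_sum, Finset.sum_mul]
    refine Finset.sum_congr rfl fun l _ => Finset.sum_congr rfl fun r _ =>
      Finset.sum_congr rfl fun s _ => by ring
  rw [piF, hΓ]
  simp only [Matrix.add_mulVec, Matrix.smul_mulVec, ← Matrix.mulVec_mulVec, hA,
    Matrix.mulVec_add, Matrix.mulVec_smul]
  congr 2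
  ext l
  simp only [Matrix.mulVec, dotProduct, Matrix.of_apply, Finset.sum_mul]
  refine Finset.sum_congr rfl fun r _ => Finset.sum_congr rfl fun s _ => by ring

/-- For arbitrary smooth `Γ`, `N` and symmetric `Γ^l_{rs}`, the forms satisfy the
holonomic and torsion-free structure equations `dτ = 0` and
`dω + Π ∧ ω + φ ∧ τ = 0` (the conditions `T = 0`, `Ω = 0` of a normal Galilean
geometry). -/
theorem holonomic_and_torsionFree (n : ℕ) (hn : 1 ≤ n)
    (Γ : JetPt n → Fin n → ℝ) (N : JetPt n → Matrix (Fin n) (Fin n) ℝ)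
    (Γ3 : JetPt n → Fin n → Fin n → Fin n → ℝ)
    (hΓ : ContDiff ℝ (⊤ : ℕ∞) Γ) (hN : ContDiff ℝ (⊤ : ℕ∞) N) (hΓ3 : ContDiff ℝ (⊤ : ℕ∞) Γ3)
    (hsym : ∀ q l r s, Γ3 q l r s = Γ3 q l s r) :
    ∀ p : GalTot n, IsUnit p.2.2.2 → ∀ u v : GalTot n,
      dF tauF p u v = 0 ∧
      dF omegaF p u v + mvWedge (piF N Γ3) omegaF p u v +
        vsWedge (phiF Γ N) tauF p u v = 0 := by
  intro p hp u v
  refine ⟨by simp [dF, tauF], ?_⟩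
  have hΓsym : (fun l => ∑ r, ∑ s, Γ3 (baseOf p) l r s *
        (v.2.1 - v.1 • p.2.2.1) r * (u.2.1 - u.1 • p.2.2.1) s) =
      fun l => ∑ r, ∑ s, Γ3 (baseOf p) l r s *
        (u.2.1 - u.1 • p.2.2.1) r * (v.2.1 - v.1 • p.2.2.1) s := by
    ext l
    rw [Finset.sum_comm]
    refine Finset.sum_congr rfl fun r _ => Finset.sum_congr rfl fun s _ => ?_
    rw [hsym]
    ring
  rw [dF, mvWedge, vsWedge, fderiv_omegaF hp, fderiv_omegaF hp, piF_mulVec N Γ3 hp,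
    piF_mulVec N Γ3 hp, hΓsym]
  simp only [phiF, tauF, Matrix.mulVec_add, Matrix.mulVec_sub, Matrix.mulVec_neg,
    Matrix.mulVec_smul, smul_add, smul_sub]
  rw [smul_comm v.1 u.1]
  module
end

section
/- For arbitrary smooth Γ, N, and symmetric Γ^l_{rs}, the curvature 2-form Φ = dφ + Π ∧ φ has no φ ∧ φ term: for every p ∈ P and all tangent vectors u, v at p satisfying τ_p(u) = τ_p(v) = 0, ω_p(u) = ω_p(v) = 0, and Π_p(u) = Π_p(v) = 0 (the zero matrix), one has Φ_p(u,v) = 0. -/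
attribute [local instance] Matrix.normedAddCommGroup Matrix.normedSpace

/-- A function that is constant on every line in direction `u` has vanishing `fderiv` along `u`
(no differentiability is needed, by the convention on `fderiv`). -/
lemma fderiv_apply_eq_zero_of_forall_add_smul_eq {E F : Type*}
    [NormedAddCommGroup E] [NormedSpace ℝ E] [NormedAddCommGroup F] [NormedSpace ℝ F]
    {f : E → F} {p u : E} (h : ∀ t : ℝ, f (p + t • u) = f p) : fderiv ℝ f p u = 0 := by
  by_cases hf : DifferentiableAt ℝ f p
  · rw [← hf.lineDeriv_eq_fderiv, lineDeriv]
    simp [h]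
  · simp [fderiv_zero_of_not_differentiableAt hf]

/-- At a frame `A ∈ GL_n(ℝ)`, a vector annihilated by `τ`, `ω` and `Π` only has a `y`-component. -/
lemma components_eq_zero_of_annihilated {n : ℕ} {N : JetPt n → Matrix (Fin n) (Fin n) ℝ}
    {Γ3 : JetPt n → Fin n → Fin n → Fin n → ℝ} {p ξ : GalTot n} (hp : IsUnit p.2.2.2)
    (hτ : tauF p ξ = 0) (hω : omegaF p ξ = 0) (hpi : piF N Γ3 p ξ = 0) :
    ξ.1 = 0 ∧ ξ.2.1 = 0 ∧ ξ.2.2.2 = 0 := by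
  have hdet := (Matrix.isUnit_iff_isUnit_det _).1 hp
  have ht : ξ.1 = 0 := hτ
  have hx : ξ.2.1 = 0 := by
    have h := congrArg p.2.2.2.mulVec hω
    simpa [omegaF, ht, Matrix.mulVec_mulVec, Matrix.mul_nonsing_inv _ hdet] using h
  have hA : (p.2.2.2)⁻¹ * ξ.2.2.2 = 0 := by
    ext i j
    simpa [piF, ht, hx] using congrFun (congrFun hpi i) j
  refine ⟨ht, hx, ?_⟩
  rw [← Matrix.mul_nonsing_inv_cancel_left p.2.2.2 ξ.2.2.2 hdet, hA, Matrix.mul_zero]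

/-- `φ(w)` does not vary in the direction `ξ` if `ξ` has only a `y`-component and `w` has
vanishing `t`- and `x`-components. -/
lemma fderiv_phiF_eq_zero {n : ℕ} (Γ : JetPt n → Fin n → ℝ)
    (N : JetPt n → Matrix (Fin n) (Fin n) ℝ) {p ξ w : GalTot n}
    (hA : ξ.2.2.2 = 0) (hwt : w.1 = 0) (hwx : w.2.1 = 0) :
    fderiv ℝ (fun q => phiF Γ N q w) p ξ = 0 :=
  fderiv_apply_eq_zero_of_forall_add_smul_eq fun t => by simp [phiF, hA, hwt, hwx]

/-- For arbitrary smooth `Γ`, `N` and symmetric `Γ^l_{rs}`, the curvature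
`Φ = dφ + Π ∧ φ` has no `φ ∧ φ` term: it vanishes on pairs of tangent vectors
annihilated by `τ`, `ω` and `Π`. -/
theorem curvature_no_phi_phi_term (n : ℕ) (hn : 1 ≤ n)
    (Γ : JetPt n → Fin n → ℝ) (N : JetPt n → Matrix (Fin n) (Fin n) ℝ)
    (Γ3 : JetPt n → Fin n → Fin n → Fin n → ℝ)
    (hΓ : ContDiff ℝ (⊤ : ℕ∞) Γ) (hN : ContDiff ℝ (⊤ : ℕ∞) N) (hΓ3 : ContDiff ℝ (⊤ : ℕ∞) Γ3)
    (hsym : ∀ q l r s, Γ3 q l r s = Γ3 q l s r) :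
    ∀ p : GalTot n, IsUnit p.2.2.2 → ∀ u v : GalTot n,
      tauF p u = 0 → tauF p v = 0 →
      omegaF p u = 0 → omegaF p v = 0 →
      piF N Γ3 p u = 0 → piF N Γ3 p v = 0 →
      curvPhi Γ N Γ3 p u v = 0 := by
  intro p hp u v hτu hτv hωu hωv hpiu hpiv
  obtain ⟨hut, hux, huA⟩ := components_eq_zero_of_annihilated hp hτu hωu hpiu
  obtain ⟨hvt, hvx, hvA⟩ := components_eq_zero_of_annihilated hp hτv hωv hpiv
  simp [curvPhi, dF, mvWedge, hpiu, hpiv, fderiv_phiF_eq_zero Γ N huA hvt hvx,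
    fderiv_phiF_eq_zero Γ N hvA hut hux]
end

section
/- For arbitrary smooth Γ, N, and symmetric Γ^l_{rs}, the τ ∧ φ part of the curvature is governed by 2N − ∂Γ/∂y: for every p = (t,x,y,A) ∈ P and all tangent vectors u, v at p satisfying ω_p(u) = ω_p(v) = 0 and Π_p(u) = Π_p(v) = 0, one has Φ_p(u,v) = A⁻¹ (2N(t,x,y) − ∂Γ/∂y(t,x,y)) A · (τ_p(u)·φ_p(v) − τ_p(v)·φ_p(u)), where ∂Γ/∂y(t,x,y) ∈ M_n(ℝ) is the Jacobian matrix of Γ with respect to the variables y. In other words, Φ ≡ A⁻¹(2N − ∂Γ/∂y)A · τ ∧ φ modulo ω. -/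
attribute [local instance] Matrix.normedAddCommGroup Matrix.normedSpace

/-- The Jacobian matrix `∂Γ/∂y` of `Γ` with respect to the variables `y`. -/
noncomputable def jacY {n : ℕ} (Γ : JetPt n → Fin n → ℝ) (q : JetPt n) :
    Matrix (Fin n) (Fin n) ℝ :=
  Matrix.of fun i k => fderiv ℝ (fun y => Γ (q.1, q.2.1, y) i) q.2.2 (Pi.single k 1)

theorem HasDerivAt.matrix_mulVec {m n : ℕ} {M : ℝ → Matrix (Fin m) (Fin n) ℝ}
    {M' : Matrix (Fin m) (Fin n) ℝ} {w : ℝ → Fin n → ℝ} {w' : Fin n → ℝ} {s : ℝ}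
    (hM : HasDerivAt M M' s) (hw : HasDerivAt w w' s) :
    HasDerivAt (fun r => (M r).mulVec (w r)) (M'.mulVec (w s) + (M s).mulVec w') s := by
  rw [hasDerivAt_pi]
  intro i
  have hMi : ∀ j, HasDerivAt (fun r => M r i j) (M' i j) s := fun j =>
    hasDerivAt_pi.1 (hasDerivAt_pi.1 hM i) j
  have hwj := hasDerivAt_pi.1 hw
  have h := HasDerivAt.fun_sum (u := Finset.univ) fun j _ => (hMi j).mul (hwj j)
  simpa [Matrix.mulVec, dotProduct, Finset.sum_add_distrib] using h

theorem DifferentiableAt.matrix_det {n : ℕ} {E : Type*} [NormedAddCommGroup E]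
    [NormedSpace ℝ E] {M : E → Matrix (Fin n) (Fin n) ℝ} {q : E}
    (hM : ∀ i j, DifferentiableAt ℝ (fun x => M x i j) q) :
    DifferentiableAt ℝ (fun x => (M x).det) q := by
  simp only [Matrix.det_apply]
  refine DifferentiableAt.fun_sum fun σ _ => ?_
  have hprod := HasFDerivAt.finsetProd (u := Finset.univ) (g := fun i x => M x (σ i) i)
    fun i _ => (hM (σ i) i).hasFDerivAt
  exact hprod.differentiableAt.const_smul _

theorem DifferentiableAt.matrix_inv_apply {n : ℕ} {E : Type*} [NormedAddCommGroup E]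
    [NormedSpace ℝ E] {M : E → Matrix (Fin n) (Fin n) ℝ} {q : E}
    (hM : ∀ i j, DifferentiableAt ℝ (fun x => M x i j) q) (hq : (M q).det ≠ 0) (i j : Fin n) :
    DifferentiableAt ℝ (fun x => (M x)⁻¹ i j) q := by
  have hadj : DifferentiableAt ℝ (fun x => (M x).adjugate i j) q := by
    simp only [Matrix.adjugate_apply]
    refine DifferentiableAt.matrix_det fun k l => ?_
    by_cases hk : k = j
    · subst hk; simp
    · simpa [Matrix.updateRow_ne hk] using hM k l
  simp only [Matrix.inv_def, Ring.inverse_eq_inv', Matrix.smul_apply, smul_eq_mul]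
  exact ((DifferentiableAt.matrix_det hM).inv hq).mul hadj

theorem jacY_mulVec {n : ℕ} {Γ : JetPt n → Fin n → ℝ} {b : JetPt n}
    (hΓ : DifferentiableAt ℝ Γ b) (w : Fin n → ℝ) :
    (jacY Γ b).mulVec w = fderiv ℝ Γ b (0, 0, w) := by
  have key : ∀ i (z : Fin n → ℝ),
      fderiv ℝ (fun y => Γ (b.1, b.2.1, y) i) b.2.2 z = fderiv ℝ Γ b (0, 0, z) i := by
    intro i z
    have hemb : HasFDerivAt (fun y : Fin n → ℝ => ((b.1, b.2.1, y) : JetPt n))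
        ((0 : (Fin n → ℝ) →L[ℝ] ℝ).prod
          ((0 : (Fin n → ℝ) →L[ℝ] (Fin n → ℝ)).prod (ContinuousLinearMap.id ℝ _))) b.2.2 :=
      (hasFDerivAt_const _ _).prodMk ((hasFDerivAt_const _ _).prodMk (hasFDerivAt_id _))
    have hcomp := HasFDerivAt.comp (g := Γ) b.2.2 hΓ.hasFDerivAt hemb
    have h := (hasFDerivAt_pi'.1 hcomp i).fderiv
    have h' := DFunLike.congr_fun h z
    simpa using h'
  ext i
  simp only [Matrix.mulVec, dotProduct, jacY, Matrix.of_apply, ← key]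
  conv_rhs => rw [← Finset.univ_sum_single w, map_sum]
  refine Finset.sum_congr rfl fun k _ => ?_
  rw [mul_comm, ← smul_eq_mul, ← map_smul, ← Pi.single_smul, smul_eq_mul, mul_one]

theorem differentiableAt_phiF {n : ℕ} {Γ : JetPt n → Fin n → ℝ}
    {N : JetPt n → Matrix (Fin n) (Fin n) ℝ} (hΓ : Differentiable ℝ Γ) (hN : Differentiable ℝ N)
    {p : GalTot n} (hp : p.2.2.2.det ≠ 0) (v : GalTot n) :
    DifferentiableAt ℝ (fun q => phiF Γ N q v) p := by
  have hbase : Differentiable ℝ (baseOf : GalTot n → JetPt n) := by unfold baseOf; fun_prop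
  have hΓi : ∀ i, Differentiable ℝ fun q : GalTot n => Γ (baseOf q) i :=
    differentiable_pi.1 (hΓ.comp hbase)
  have hNij : ∀ i j, Differentiable ℝ fun q : GalTot n => N (baseOf q) i j := fun i =>
    differentiable_pi.1 (differentiable_pi.1 (hN.comp hbase) i)
  have hentry : ∀ i j, Differentiable ℝ fun q : GalTot n => q.2.2.2 i j := fun i =>
    differentiable_pi.1 (differentiable_pi.1
      (differentiable_snd.comp (differentiable_snd.comp differentiable_snd)) i)
  have hinv : ∀ i j, DifferentiableAt ℝ (fun q : GalTot n => (q.2.2.2)⁻¹ i j) p := fun i j =>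
    DifferentiableAt.matrix_inv_apply (M := fun q : GalTot n => q.2.2.2)
      (fun i j => hentry i j p) hp i j
  have hy : ∀ j, Differentiable ℝ fun q : GalTot n => q.2.2.1 j := fun j => by fun_prop
  refine differentiableAt_pi.2 fun i => ?_
  simp only [phiF, Matrix.mulVec, dotProduct, Pi.add_apply, Pi.smul_apply, Pi.sub_apply,
    smul_eq_mul]
  refine DifferentiableAt.fun_sum fun j _ => (hinv i j).fun_mul ?_
  refine (((hΓi j p).const_mul v.1).const_add (v.2.2.1 j)).fun_add ?_
  exact DifferentiableAt.fun_sum fun k _ =>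
    (hNij j k p).fun_mul (((hy k p).const_mul v.1).const_sub (v.2.1 k))

theorem mulVec_fderiv_phiF {n : ℕ} {Γ : JetPt n → Fin n → ℝ}
    {N : JetPt n → Matrix (Fin n) (Fin n) ℝ} (hΓ : Differentiable ℝ Γ) (hN : Differentiable ℝ N)
    {p : GalTot n} (hp : p.2.2.2.det ≠ 0) (u : GalTot n) {v : GalTot n}
    (hv : v.2.1 - v.1 • p.2.2.1 = 0) :
    p.2.2.2.mulVec (fderiv ℝ (fun q => phiF Γ N q v) p u) =
      v.1 • fderiv ℝ Γ (baseOf p) (baseOf u) - v.1 • (N (baseOf p)).mulVec u.2.2.1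
        - u.2.2.2.mulVec (phiF Γ N p v) := by
  have hline : ∀ {F : Type} [NormedAddCommGroup F] [NormedSpace ℝ F] (a b : F),
      HasDerivAt (fun s : ℝ => a + s • b) b 0 := fun a b => by
    simpa using ((hasDerivAt_id (0 : ℝ)).smul_const b).const_add a
  have hφ : HasDerivAt (fun s : ℝ => phiF Γ N (p + s • u) v)
      (fderiv ℝ (fun q => phiF Γ N q v) p u) 0 := by
    have h := (differentiableAt_phiF hΓ hN hp v).hasFDerivAt
    exact HasFDerivAt.comp_hasDerivAt_of_eq (f := fun s : ℝ => p + s • u) 0 h (hline p u)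
      (by simp)
  have hA : HasDerivAt (fun s : ℝ => p.2.2.2 + s • u.2.2.2) u.2.2.2 0 := hline _ _
  have hL := hA.matrix_mulVec hφ
  have hΓ' : HasDerivAt (fun s : ℝ => Γ (baseOf p + s • baseOf u))
      (fderiv ℝ Γ (baseOf p) (baseOf u)) 0 :=
    HasFDerivAt.comp_hasDerivAt_of_eq (f := fun s : ℝ => baseOf p + s • baseOf u) 0
      (hΓ _).hasFDerivAt (hline _ _) (by simp)
  have hN' : HasDerivAt (fun s : ℝ => N (baseOf p + s • baseOf u))
      (fderiv ℝ N (baseOf p) (baseOf u)) 0 :=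
    HasFDerivAt.comp_hasDerivAt_of_eq (f := fun s : ℝ => baseOf p + s • baseOf u) 0
      (hN _).hasFDerivAt (hline _ _) (by simp)
  have hR := ((hΓ'.const_smul v.1).const_add v.2.2.1).add
    (hN'.matrix_mulVec (((hline p.2.2.1 u.2.2.1).const_smul v.1).const_sub v.2.1))
  have hdet : ∀ᶠ s : ℝ in nhds 0, (p.2.2.2 + s • u.2.2.2).det ≠ 0 := by
    have hc : Continuous fun s : ℝ => (p.2.2.2 + s • u.2.2.2).det := by fun_prop
    exact hc.continuousAt.eventually_ne (by simpa using hp)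
  have hEq : (fun s : ℝ => (p.2.2.2 + s • u.2.2.2).mulVec (phiF Γ N (p + s • u) v)) =ᶠ[nhds 0]
      fun s : ℝ => v.2.2.1 + v.1 • Γ (baseOf p + s • baseOf u) +
        (N (baseOf p + s • baseOf u)).mulVec (v.2.1 - v.1 • (p.2.2.1 + s • u.2.2.1)) := by
    filter_upwards [hdet] with s hs
    change (p.2.2.2 + s • u.2.2.2).mulVec ((p.2.2.2 + s • u.2.2.2)⁻¹.mulVec _) = _
    rw [Matrix.mulVec_mulVec, Matrix.mul_nonsing_inv _ (isUnit_iff_ne_zero.2 hs),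
      Matrix.one_mulVec]
    rfl
  have h := hL.unique (hR.congr_of_eventuallyEq hEq)
  simp only [Pi.smul_apply, zero_smul, add_zero, hv, Matrix.mulVec_zero, zero_add, Matrix.mulVec_neg,
    Matrix.mulVec_smul] at h
  rw [eq_sub_iff_add_eq', h, sub_eq_add_neg]

theorem mulVec_eq_of_piF_eq_zero {n : ℕ} {N : JetPt n → Matrix (Fin n) (Fin n) ℝ}
    {Γ3 : JetPt n → Fin n → Fin n → Fin n → ℝ} {p u : GalTot n} (hp : p.2.2.2.det ≠ 0)
    (hu : u.2.1 - u.1 • p.2.2.1 = 0) (hP : piF N Γ3 p u = 0) (w : Fin n → ℝ) :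
    u.2.2.2.mulVec w = -(u.1 • (N (baseOf p)).mulVec (p.2.2.2.mulVec w)) := by
  have hsum : (p.2.2.2)⁻¹ * u.2.2.2 + u.1 • ((p.2.2.2)⁻¹ * N (baseOf p) * p.2.2.2) = 0 := by
    rw [← hP, piF, hu]
    ext i j
    simp
  have hmul : u.2.2.2 = -(u.1 • (N (baseOf p) * p.2.2.2)) := by
    have h := congrArg (p.2.2.2 * ·) hsum
    have hunit : p.2.2.2 * (p.2.2.2)⁻¹ = 1 :=
      Matrix.mul_nonsing_inv _ (isUnit_iff_ne_zero.2 hp)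
    simp only [mul_add, mul_smul_comm, ← mul_assoc, hunit, one_mul, mul_zero] at h
    exact eq_neg_of_add_eq_zero_left h
  rw [hmul, Matrix.neg_mulVec, Matrix.smul_mulVec, Matrix.mulVec_mulVec]

/-- For arbitrary smooth `Γ`, `N` and symmetric `Γ^l_{rs}`, the `τ ∧ φ` part of
the curvature is governed by `2N − ∂Γ/∂y`: modulo `ω`,
`Φ ≡ A⁻¹(2N − ∂Γ/∂y)A · τ ∧ φ`. -/
theorem curvature_tau_phi_term (n : ℕ) (hn : 1 ≤ n)
    (Γ : JetPt n → Fin n → ℝ) (N : JetPt n → Matrix (Fin n) (Fin n) ℝ)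
    (Γ3 : JetPt n → Fin n → Fin n → Fin n → ℝ)
    (hΓ : ContDiff ℝ (⊤ : ℕ∞) Γ) (hN : ContDiff ℝ (⊤ : ℕ∞) N) (hΓ3 : ContDiff ℝ (⊤ : ℕ∞) Γ3)
    (hsym : ∀ q l r s, Γ3 q l r s = Γ3 q l s r) :
    ∀ p : GalTot n, IsUnit p.2.2.2 → ∀ u v : GalTot n,
      omegaF p u = 0 → omegaF p v = 0 →
      piF N Γ3 p u = 0 → piF N Γ3 p v = 0 →
      curvPhi Γ N Γ3 p u v =
        ((p.2.2.2)⁻¹ * ((2 : ℝ) • N (baseOf p) - jacY Γ (baseOf p)) * p.2.2.2).mulVec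
          (tauF p u • phiF Γ N p v - tauF p v • phiF Γ N p u) := by
  intro p hpu u v hωu hωv hPu hPv
  have hunit : IsUnit p.2.2.2.det := (Matrix.isUnit_iff_isUnit_det _).1 hpu
  have hp : p.2.2.2.det ≠ 0 := hunit.ne_zero
  have hΓd : Differentiable ℝ Γ := hΓ.differentiable (by simp)
  have hNd : Differentiable ℝ N := hN.differentiable (by simp)
  have hcancel : ∀ w, p.2.2.2.mulVec ((p.2.2.2)⁻¹.mulVec w) = w := fun w => by
    rw [Matrix.mulVec_mulVec, Matrix.mul_nonsing_inv _ hunit, Matrix.one_mulVec]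
  have hcancel' : ∀ w, (p.2.2.2)⁻¹.mulVec (p.2.2.2.mulVec w) = w := fun w => by
    rw [Matrix.mulVec_mulVec, Matrix.nonsing_inv_mul _ hunit, Matrix.one_mulVec]
  have horiz : ∀ ξ, omegaF p ξ = 0 → ξ.2.1 - ξ.1 • p.2.2.1 = 0 := fun ξ h => by
    rw [← hcancel (ξ.2.1 - ξ.1 • p.2.2.1), ← omegaF, h, Matrix.mulVec_zero]
  have hu := horiz u hωu
  have hv := horiz v hωv
  have hφ : ∀ ξ : GalTot n, ξ.2.1 - ξ.1 • p.2.2.1 = 0 →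
      p.2.2.2.mulVec (phiF Γ N p ξ) = ξ.2.2.1 + ξ.1 • Γ (baseOf p) := fun ξ h => by
    rw [phiF, hcancel, h, Matrix.mulVec_zero, add_zero]
  have hbase : v.1 • baseOf u - u.1 • baseOf v =
      (0, 0, v.1 • u.2.2.1 - u.1 • v.2.2.1) := by
    refine Prod.ext ?_ (Prod.ext ?_ rfl)
    · simp [baseOf, mul_comm]
    · simp [baseOf, sub_eq_zero.1 hu, sub_eq_zero.1 hv, smul_smul, mul_comm]
  have hΓder : v.1 • fderiv ℝ Γ (baseOf p) (baseOf u) - u.1 • fderiv ℝ Γ (baseOf p) (baseOf v) =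
      (jacY Γ (baseOf p)).mulVec (v.1 • u.2.2.1 - u.1 • v.2.2.1) := by
    rw [jacY_mulVec (hΓd _), ← hbase, map_sub, map_smul, map_smul]
  rw [← hcancel' (curvPhi Γ N Γ3 p u v), ← Matrix.mulVec_mulVec, ← Matrix.mulVec_mulVec]
  congr 1
  rw [curvPhi, dF, mvWedge, hPu, hPv, Matrix.zero_mulVec, Matrix.zero_mulVec, sub_zero, add_zero,
    Matrix.mulVec_sub, mulVec_fderiv_phiF hΓd hNd hp u hv, mulVec_fderiv_phiF hΓd hNd hp v hu,
    mulVec_eq_of_piF_eq_zero hp hu hPu, mulVec_eq_of_piF_eq_zero hp hv hPv,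
    Matrix.mulVec_sub, Matrix.mulVec_smul, Matrix.mulVec_smul, hφ u hu, hφ v hv]
  have hy : tauF p u • (v.2.2.1 + v.1 • Γ (baseOf p)) - tauF p v • (u.2.2.1 + u.1 • Γ (baseOf p)) =
      -(v.1 • u.2.2.1 - u.1 • v.2.2.1) := by
    simp only [tauF]; module
  rw [hy, Matrix.sub_mulVec, Matrix.mulVec_neg (A := jacY Γ (baseOf p)), ← hΓder]
  simp only [Matrix.smul_mulVec, Matrix.mulVec_add, Matrix.mulVec_sub, Matrix.mulVec_smul,
    Matrix.mulVec_neg]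
  module
end

section
/- Suppose N(t,x,y) = ½ ∂Γ/∂y(t,x,y), with Γ smooth and the Γ^l_{rs} arbitrary smooth symmetric functions. Then the ω ∧ φ coefficient of the curvature is Γ^l_{rs} − ½ ∂²Γ^l/∂y^r∂y^s: for every p = (t,x,y,A) ∈ P, every tangent vector u at p with τ_p(u) = 0, φ_p(u) = 0, Π_p(u) = 0, and every tangent vector v at p with τ_p(v) = 0, ω_p(v) = 0, Π_p(v) = 0, one has, for each i, Φ_p(u,v)^i = Σ_{l,r,s} (A⁻¹)^i_l ( Γ^l_{rs}(t,x,y) − ½ ∂²Γ^l/∂y^r∂y^s(t,x,y) ) · (A·φ_p(v))^r · (A·ω_p(u))^s. (Consequently, prescribing the symmetric part Q^i_{(jk)} of this coefficient determines the symmetric functions Γ^l_{rs} uniquely.) -/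
attribute [local instance] Matrix.normedAddCommGroup Matrix.normedSpace

/-- The second partial derivative `∂²Γ^l/∂y^r∂y^s` of `Γ` in the variables `y`. -/
noncomputable def hessY {n : ℕ} (Γ : JetPt n → Fin n → ℝ) (q : JetPt n)
    (l r s : Fin n) : ℝ :=
  fderiv ℝ (fun y => fderiv ℝ (fun y' => Γ (q.1, q.2.1, y') l) y (Pi.single s 1))
    q.2.2 (Pi.single r 1)

/-- Derivative of matrix inversion at an invertible matrix. -/
theorem hasFDerivAt_matrix_inv {n : ℕ} {A : Matrix (Fin n) (Fin n) ℝ} (hA : IsUnit A) :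
    ∃ L : Matrix (Fin n) (Fin n) ℝ →L[ℝ] Matrix (Fin n) (Fin n) ℝ,
      HasFDerivAt (fun B : Matrix (Fin n) (Fin n) ℝ => B⁻¹) L A ∧
        ∀ B, L B = -(A⁻¹ * B * A⁻¹) := by
  obtain ⟨a, rfl⟩ := hA
  let R : NormedRing (Matrix (Fin n) (Fin n) ℝ) := Matrix.linftyOpNormedRing
  let R' : NormedAlgebra ℝ (Matrix (Fin n) (Fin n) ℝ) := Matrix.linftyOpNormedAlgebra
  have : @CompleteSpace (Matrix (Fin n) (Fin n) ℝ) R.toMetricSpace.toUniformSpace :=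
    FiniteDimensional.complete ℝ _
  refine ⟨-ContinuousLinearMap.mulLeftRight ℝ _ (↑a⁻¹ : Matrix (Fin n) (Fin n) ℝ)
    (↑a⁻¹ : Matrix (Fin n) (Fin n) ℝ), ?_, fun B => ?_⟩
  · have h := hasFDerivAt_ringInverse (𝕜 := ℝ) a
    rw [show (fun B : Matrix (Fin n) (Fin n) ℝ => B⁻¹) = Ring.inverse from
      funext Matrix.nonsing_inv_eq_ringInverse]
    exact h
  · change -((↑a⁻¹ : Matrix (Fin n) (Fin n) ℝ) * B * (↑a⁻¹ : Matrix (Fin n) (Fin n) ℝ)) = _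
    rw [Matrix.coe_units_inv]

/-- The entries of the Jacobian of a smooth map are differentiable. -/
theorem differentiable_jacY {n : ℕ} {Γ : JetPt n → Fin n → ℝ} (hΓ : ContDiff ℝ (⊤ : ℕ∞) Γ)
    (l s : Fin n) : Differentiable ℝ (fun q => jacY Γ q l s) := by
  have hd : Differentiable ℝ (fun q => Γ q l) :=
    differentiable_pi.1 (hΓ.differentiable (by simp)) l
  have key : (fun q => jacY Γ q l s) =
      fun q => fderiv ℝ (fun q => Γ q l) q (0, 0, Pi.single s 1) := by
    funext q
    have h1 : HasFDerivAt (fun y : Fin n → ℝ => ((q.1, q.2.1, y) : JetPt n))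
        ((0 : (Fin n → ℝ) →L[ℝ] ℝ).prod
          ((0 : (Fin n → ℝ) →L[ℝ] (Fin n → ℝ)).prod (ContinuousLinearMap.id ℝ _))) q.2.2 :=
      (hasFDerivAt_const _ _).prodMk ((hasFDerivAt_const _ _).prodMk (hasFDerivAt_id _))
    have h2 := (hd (q.1, q.2.1, q.2.2)).hasFDerivAt.comp q.2.2 h1
    have h3 := h2.fderiv
    simp only [Function.comp_def] at h3
    simp [jacY, h3]
  rw [key]
  have hc : ContDiff ℝ (⊤ : ℕ∞) (fun q => Γ q l) := contDiff_pi.1 hΓ l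
  have : ContDiff ℝ 1 (fderiv ℝ (fun q => Γ q l)) :=
    hc.fderiv_right (by norm_cast)
  exact (this.differentiable (by simp)).clm_apply (differentiable_const _)

/-- The derivative of a Jacobian entry in a vertical direction is given by second partials. -/
theorem fderiv_jacY_vertical {n : ℕ} {Γ : JetPt n → Fin n → ℝ}
    (hΓ : ContDiff ℝ (⊤ : ℕ∞) Γ) (q : JetPt n) (w : Fin n → ℝ) (l s : Fin n) :
    fderiv ℝ (fun q => jacY Γ q l s) q (0, 0, w) = ∑ r, hessY Γ q l r s * w r := by
  have h1 : HasFDerivAt (fun y : Fin n → ℝ => ((q.1, q.2.1, y) : JetPt n))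
      ((0 : (Fin n → ℝ) →L[ℝ] ℝ).prod
        ((0 : (Fin n → ℝ) →L[ℝ] (Fin n → ℝ)).prod (ContinuousLinearMap.id ℝ _))) q.2.2 :=
    (hasFDerivAt_const _ _).prodMk ((hasFDerivAt_const _ _).prodMk (hasFDerivAt_id _))
  have h2 := (differentiable_jacY hΓ l s (q.1, q.2.1, q.2.2)).hasFDerivAt.comp q.2.2 h1
  have h3 := h2.fderiv
  simp only [Function.comp_def, jacY, Matrix.of_apply] at h3
  have hw : ((0, 0, w) : JetPt n) = ∑ r, w r • ((0, 0, Pi.single r 1) : JetPt n) := by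
    ext i <;> simp [Prod.fst_sum, Prod.snd_sum, Finset.sum_apply, Pi.single_apply]
  rw [hw, map_sum]
  refine Finset.sum_congr rfl fun r _ => ?_
  rw [map_smul, smul_eq_mul, mul_comm]
  simp [hessY, h3, jacY]

/-- Derivative of an entry of the inverse frame on the total space. -/
theorem hasFDerivAt_frame_inv_entry {n : ℕ} {p : GalTot n} (hp : IsUnit p.2.2.2)
    (i l : Fin n) :
    ∃ E : GalTot n →L[ℝ] ℝ, HasFDerivAt (fun q : GalTot n => (q.2.2.2)⁻¹ i l) E p ∧
      ∀ ξ, E ξ = -((p.2.2.2)⁻¹ * ξ.2.2.2 * (p.2.2.2)⁻¹) i l := by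
  obtain ⟨L, hL, hLB⟩ := hasFDerivAt_matrix_inv hp
  have hproj : HasFDerivAt (fun q : GalTot n => q.2.2.2) _ p :=
    ((ContinuousLinearMap.snd ℝ (Fin n → ℝ) (Matrix (Fin n) (Fin n) ℝ)).comp
      ((ContinuousLinearMap.snd ℝ (Fin n → ℝ) _).comp
        (ContinuousLinearMap.snd ℝ ℝ _))).hasFDerivAt
  have h := ((LinearMap.toContinuousLinearMap
    (Matrix.entryLinearMap ℝ ℝ i l)).hasFDerivAt).comp p (hL.comp p hproj)
  exact ⟨_, h, fun ξ => congrFun (congrFun (hLB ξ.2.2.2) i) l⟩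

/-- Derivative of a component of `φ(ξ)` for a constant vector `ξ` with `ξ_t = 0`. -/
theorem fderiv_phiF_apply {n : ℕ} {Γ : JetPt n → Fin n → ℝ}
    {N : JetPt n → Matrix (Fin n) (Fin n) ℝ}
    (hN : ∀ l s, Differentiable ℝ (fun q => N q l s)) {p : GalTot n}
    (hp : IsUnit p.2.2.2) (ξ η : GalTot n) (hξ : ξ.1 = 0) (i : Fin n) :
    fderiv ℝ (fun q => phiF Γ N q ξ) p η i =
      ∑ l, (-((p.2.2.2)⁻¹ * η.2.2.2 * (p.2.2.2)⁻¹) i l *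
          (ξ.2.2.1 l + ∑ s, N (baseOf p) l s * ξ.2.1 s) +
        (p.2.2.2)⁻¹ i l *
          ∑ s, fderiv ℝ (fun q => N q l s) (baseOf p) (baseOf η) * ξ.2.1 s) := by
  choose E hE hEξ using fun i l => hasFDerivAt_frame_inv_entry hp i l
  obtain ⟨B, hB, hBη⟩ : ∃ B : GalTot n →L[ℝ] JetPt n,
      HasFDerivAt (baseOf (n := n)) B p ∧ B η = baseOf η :=
    ⟨_, ((ContinuousLinearMap.fst ℝ ℝ _).prod
      (((ContinuousLinearMap.fst ℝ (Fin n → ℝ) _).comp (ContinuousLinearMap.snd ℝ ℝ _)).prod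
        ((ContinuousLinearMap.fst ℝ (Fin n → ℝ) (Matrix (Fin n) (Fin n) ℝ)).comp
          ((ContinuousLinearMap.snd ℝ (Fin n → ℝ) _).comp
            (ContinuousLinearMap.snd ℝ ℝ _))))).hasFDerivAt, rfl⟩
  have hcomp : ∀ i, ∃ D : GalTot n →L[ℝ] ℝ, HasFDerivAt (fun q => phiF Γ N q ξ i) D p ∧
      D η = ∑ l, (-((p.2.2.2)⁻¹ * η.2.2.2 * (p.2.2.2)⁻¹) i l *
          (ξ.2.2.1 l + ∑ s, N (baseOf p) l s * ξ.2.1 s) +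
        (p.2.2.2)⁻¹ i l *
          ∑ s, fderiv ℝ (fun q => N q l s) (baseOf p) (baseOf η) * ξ.2.1 s) := fun i => by
    let D : GalTot n →L[ℝ] ℝ := ∑ l, ((p.2.2.2)⁻¹ i l • (∑ s, ξ.2.1 s •
      (fderiv ℝ (fun q => N q l s) (baseOf p)).comp B) +
        (ξ.2.2.1 l + ∑ s, N (baseOf p) l s * ξ.2.1 s) • E i l)
    refine ⟨D, (HasFDerivAt.fun_sum (u := Finset.univ) fun l _ => (hE i l).mul
      ((HasFDerivAt.fun_sum (u := Finset.univ) fun s _ =>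
        ((hN l s (baseOf p)).hasFDerivAt.comp p hB).mul_const (ξ.2.1 s)).const_add
          (ξ.2.2.1 l))).congr_of_eventuallyEq
      (Filter.Eventually.of_forall fun q => by
        simp [phiF, hξ, Matrix.mulVec, dotProduct]), ?_⟩
    simp only [D, _root_.sum_apply, _root_.add_apply, _root_.smul_apply, hEξ, smul_eq_mul,
      ContinuousLinearMap.comp_apply, hBη]
    refine Finset.sum_congr rfl fun l _ => ?_
    rw [add_comm, mul_comm (ξ.2.2.1 l + _)]
    simp [mul_comm]
  choose D hD hDη using hcomp
  have hφ : HasFDerivAt (fun q => phiF Γ N q ξ) (ContinuousLinearMap.pi D) p :=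
    hasFDerivAt_pi.2 hD
  rw [hφ.fderiv]
  exact hDη i

/-- With `N = ½ ∂Γ/∂y`, the `ω ∧ φ` coefficient of the curvature is
`Γ^l_{rs} − ½ ∂²Γ^l/∂y^r∂y^s`:
`Φ_p(u,v)^i = Σ_{l,r,s} (A⁻¹)^i_l (Γ^l_{rs} − ½ ∂²Γ^l/∂y^r∂y^s) (Aφ_p(v))^r (Aω_p(u))^s`
whenever `τ_p(u) = 0`, `φ_p(u) = 0`, `Π_p(u) = 0` and `τ_p(v) = 0`, `ω_p(v) = 0`,
`Π_p(v) = 0`. -/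
theorem curvature_omega_phi_term (n : ℕ) (hn : 1 ≤ n)
    (Γ : JetPt n → Fin n → ℝ) (N : JetPt n → Matrix (Fin n) (Fin n) ℝ)
    (Γ3 : JetPt n → Fin n → Fin n → Fin n → ℝ)
    (hΓ : ContDiff ℝ (⊤ : ℕ∞) Γ) (hΓ3 : ContDiff ℝ (⊤ : ℕ∞) Γ3)
    (hsym : ∀ q l r s, Γ3 q l r s = Γ3 q l s r)
    (hNdef : N = fun q => (1 / 2 : ℝ) • jacY Γ q) :
    ∀ p : GalTot n, IsUnit p.2.2.2 → ∀ u v : GalTot n,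
      tauF p u = 0 → phiF Γ N p u = 0 → piF N Γ3 p u = 0 →
      tauF p v = 0 → omegaF p v = 0 → piF N Γ3 p v = 0 →
      ∀ i, curvPhi Γ N Γ3 p u v i =
        ∑ l, ∑ r, ∑ s,
          (p.2.2.2)⁻¹ i l *
            (Γ3 (baseOf p) l r s - (1 / 2 : ℝ) * hessY Γ (baseOf p) l r s) *
            (p.2.2.2.mulVec (phiF Γ N p v)) r *
            (p.2.2.2.mulVec (omegaF p u)) s := by
  intro p hp u v hut _ hpu hvt hωv hpv i
  have hdet : IsUnit p.2.2.2.det := (Matrix.isUnit_iff_isUnit_det _).1 hp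
  replace hut : u.1 = 0 := hut
  replace hvt : v.1 = 0 := hvt
  have hvx : v.2.1 = 0 := by
    have := congrArg p.2.2.2.mulVec hωv
    simpa [omegaF, hvt, Matrix.mulVec_mulVec, Matrix.mul_nonsing_inv _ hdet] using this
  have hvA : v.2.2.2 = 0 := by
    have h : (p.2.2.2)⁻¹ * v.2.2.2 = 0 := by
      ext i j
      simpa [piF, hvt, hvx] using congrFun (congrFun hpv i) j
    have := congrArg (p.2.2.2 * ·) h
    simpa [← mul_assoc, Matrix.mul_nonsing_inv _ hdet] using this
  have huA : ∀ i j, ((p.2.2.2)⁻¹ * u.2.2.2) i j = -∑ l, ∑ r, ∑ s,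
      (p.2.2.2)⁻¹ i l * Γ3 (baseOf p) l r s * p.2.2.2 r j * u.2.1 s := fun i j => by
    have := congrFun (congrFun hpu i) j
    simp only [piF, hut, Matrix.add_apply, zero_smul, sub_zero, Matrix.of_apply, add_zero] at this
    exact eq_neg_of_add_eq_zero_left this
  have hN : ∀ l s, Differentiable ℝ (fun q => N q l s) := fun l s => by
    simpa [hNdef] using (differentiable_jacY hΓ l s).const_mul (1 / 2 : ℝ)
  have hDN : ∀ l s, fderiv ℝ (fun q => N q l s) (baseOf p) (baseOf v) =
      ∑ r, (1 / 2 : ℝ) * hessY Γ (baseOf p) l r s * v.2.2.1 r := fun l s => by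
    have hb : baseOf v = (0, 0, v.2.2.1) := by simp [baseOf, hvt, hvx]
    have hf : (fun q => N q l s) = fun q => (1 / 2 : ℝ) * jacY Γ q l s := by
      simp [hNdef]
    rw [hb, hf, fderiv_const_mul (differentiable_jacY hΓ l s _)]
    simp only [_root_.smul_apply, fderiv_jacY_vertical hΓ, smul_eq_mul,
      Finset.mul_sum, mul_assoc]
  have hφ : p.2.2.2.mulVec (phiF Γ N p v) = v.2.2.1 := by
    simp [phiF, hvt, hvx, Matrix.mulVec_mulVec, Matrix.mul_nonsing_inv _ hdet]
  have hω : p.2.2.2.mulVec (omegaF p u) = u.2.1 := by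
    simp [omegaF, hut, Matrix.mulVec_mulVec, Matrix.mul_nonsing_inv _ hdet]
  have hfirst : ∑ j, ((p.2.2.2)⁻¹ * u.2.2.2 * (p.2.2.2)⁻¹) i j * v.2.2.1 j =
      -∑ l, ∑ r, ∑ s, (p.2.2.2)⁻¹ i l * Γ3 (baseOf p) l r s * v.2.2.1 r * u.2.1 s := by
    change (((p.2.2.2)⁻¹ * u.2.2.2 * (p.2.2.2)⁻¹).mulVec v.2.2.1) i = _
    rw [← Matrix.mulVec_mulVec]
    set z := (p.2.2.2)⁻¹.mulVec v.2.2.1 with hz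
    have hAz : v.2.2.1 = p.2.2.2.mulVec z := by
      simp [hz, Matrix.mulVec_mulVec, Matrix.mul_nonsing_inv _ hdet]
    rw [hAz]
    simp only [Matrix.mulVec, dotProduct, huA, neg_mul, Finset.sum_neg_distrib, Finset.sum_mul,
      Finset.mul_sum]
    congr 1
    rw [Finset.sum_comm]
    refine Finset.sum_congr rfl fun l _ => ?_
    rw [Finset.sum_comm]
    refine Finset.sum_congr rfl fun r _ => ?_
    rw [Finset.sum_comm]
    refine Finset.sum_congr rfl fun s _ => Finset.sum_congr rfl fun j _ => ?_
    ring
  simp only [curvPhi, dF, mvWedge, hpu, hpv, Matrix.zero_mulVec, sub_zero, add_zero,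
    Pi.sub_apply, fderiv_phiF_apply hN hp _ _ hut, fderiv_phiF_apply hN hp _ _ hvt, hφ, hω,
    hvx, hvA, hDN]
  simp only [Pi.zero_apply, mul_zero, zero_mul, Finset.sum_const_zero, add_zero, neg_mul,
    Matrix.zero_apply, neg_zero, zero_add,
    Finset.sum_neg_distrib, hfirst, neg_neg, mul_sub, sub_mul, Finset.sum_sub_distrib]
  congr 1
  refine Finset.sum_congr rfl fun l _ => ?_
  simp only [Finset.sum_mul, Finset.mul_sum]
  rw [Finset.sum_comm]
  refine Finset.sum_congr rfl fun r _ => Finset.sum_congr rfl fun s _ => ?_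
  ring
end
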